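/- arXiv:1211.6775 — 3 statements merged into one kernel-verified Lean document; each statement's English description precedes it below -/
import Mathlib

section
/- Let X be a finite uniform d-dimensional simplicial complex with d ≥ 2 and 0 ≤ p < 1, let K_{d−1} be the maximal degree of a (d−1)-cell of X and K_{d−2} the maximal number of (d−1)-cells containing a single (d−2)-cell of X. Then for every oriented (d−1)-cell σ₀ and every n ≥ 0, the expectation process of the p-lazy (d−1)-walk satisfies (1/√(K_{d−2}·K_{d−1}))·((p(d−1)+1)/d)^n ≤ ‖E_n^{σ₀}‖ ≤ max(|2p−1|, (p(d−1)+1)/d)^n, where ‖·‖ is the norm induced by the inner product on Ω^{d−1}. -/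
open scoped BigOperators Classical
open Filter Topology

noncomputable section

/-- A simplicial complex on a vertex set `V`: a family of finite subsets of `V`
(the cells) closed under taking nonempty subsets. -/
structure SComplex (V : Type*) where
  cells : Set (Finset V)
  down_closed : ∀ ⦃s t : Finset V⦄, s ∈ cells → t ⊆ s → t.Nonempty → t ∈ cells

namespace SComplex

variable {V : Type*} (X : SComplex V)

/-- The tuple `σ` of `n` vertices spans an `(n-1)`-dimensional cell of `X`. -/
def IsCellT {n : ℕ} (σ : Fin n → V) : Prop :=
  Function.Injective σ ∧ Finset.image σ Finset.univ ∈ X.cells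

/-- The degree of a cell `s`: the number of cells with one more vertex containing it. -/
def degS (s : Finset V) : ℕ :=
  Set.ncard {t : Finset V | t ∈ X.cells ∧ t.card = s.card + 1 ∧ s ⊆ t}

/-- Degree of the cell spanned by a tuple. -/
def degT {n : ℕ} (σ : Fin n → V) : ℕ :=
  X.degS (Finset.image σ Finset.univ)

/-- An `(n-1)`-form: an alternating function on oriented `(n-1)`-cells, encoded as a
function on `n`-tuples of vertices which vanishes off the cells of `X` and is
antisymmetric under permutations. -/
def IsForm (n : ℕ) (f : (Fin n → V) → ℝ) : Prop :=
  (∀ σ, ¬ X.IsCellT σ → f σ = 0) ∧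
  ∀ (σ : Fin n → V) (π : Equiv.Perm (Fin n)),
    f (σ ∘ π) = ((Equiv.Perm.sign π : ℤ) : ℝ) * f σ

/-- The Dirac form `𝟙_{σ₀}`: 1 at `σ₀`, -1 at the reversed orientation, 0 elsewhere. -/
def dirac {n : ℕ} (σ₀ : Fin n → V) : (Fin n → V) → ℝ := fun σ =>
  if ∃ π : Equiv.Perm (Fin n), Equiv.Perm.sign π = 1 ∧ σ = σ₀ ∘ π then 1
  else if ∃ π : Equiv.Perm (Fin n), Equiv.Perm.sign π = -1 ∧ σ = σ₀ ∘ π then -1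
  else 0

/-- The boundary operator: `(∂f)(σ) = Σ_{v : vσ ∈ X} f(vσ)`. -/
def bdry {n : ℕ} (f : (Fin (n + 1) → V) → ℝ) : (Fin n → V) → ℝ := fun σ =>
  ∑ᶠ v ∈ {v : V | X.IsCellT (Fin.cons v σ)}, f (Fin.cons v σ)

/-- The weighted sum of `f` over the neighbours of `σ`:
`Σ_{σ' ∼ σ} f(σ')/deg σ' = Σ_{v ◁ σ} Σ_i (-1)^i f(v(σ∖σ_i))/deg(v(σ∖σ_i))`. -/
def nbrW {n : ℕ} (f : (Fin (n + 1) → V) → ℝ) : (Fin (n + 1) → V) → ℝ := fun σ =>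
  ∑ᶠ v ∈ {v : V | X.IsCellT (Fin.cons v σ)},
    ∑ i : Fin (n + 1),
      (-1 : ℝ) ^ (i : ℕ) * f (Fin.cons v (σ ∘ i.succAbove)) /
        (X.degT (Fin.cons v (σ ∘ i.succAbove)) : ℝ)

/-- The unweighted sum of `f` over the neighbours of `σ`: `Σ_{σ' ∼ σ} f(σ')`. -/
def nbrU {n : ℕ} (f : (Fin (n + 1) → V) → ℝ) : (Fin (n + 1) → V) → ℝ := fun σ =>
  ∑ᶠ v ∈ {v : V | X.IsCellT (Fin.cons v σ)},
    ∑ i : Fin (n + 1), (-1 : ℝ) ^ (i : ℕ) * f (Fin.cons v (σ ∘ i.succAbove))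

/-- The upper Laplacian `(Δ⁺f)(σ) = f(σ) - Σ_{σ'∼σ} f(σ')/deg σ'`. -/
def lapUp {n : ℕ} (f : (Fin (n + 1) → V) → ℝ) : (Fin (n + 1) → V) → ℝ := fun σ =>
  f σ - X.nbrW f σ

/-- The transition operator of the `p`-lazy walk:
`(Af)(σ) = p f(σ) + ((1-p)/d) Σ_{σ'∼σ} f(σ')/deg σ'`, where `d = n+1`. -/
def transOp {n : ℕ} (p : ℝ) (f : (Fin (n + 1) → V) → ℝ) : (Fin (n + 1) → V) → ℝ := fun σ =>
  p * f σ + ((1 - p) / ((n : ℝ) + 1)) * X.nbrW f σ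

/-- The normalized expectation process `Ẽ_nn = (d/(p(d-1)+1))^nn • A^nn 𝟙_{σ₀}`. -/
def nexp {n : ℕ} (p : ℝ) (σ₀ : Fin (n + 1) → V) (nn : ℕ) : (Fin (n + 1) → V) → ℝ :=
  (((n : ℝ) + 1) / (p * (n : ℝ) + 1)) ^ nn • (X.transOp p)^[nn] (SComplex.dirac σ₀)

/-- The weighted inner product `⟨f,g⟩ = Σ_{σ ∈ X^{n-1}} f(σ)g(σ)/deg σ`
(each unoriented cell is represented by `n!` tuples). -/
def innerW [Fintype V] {n : ℕ} (f g : (Fin n → V) → ℝ) : ℝ :=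
  (1 / (n.factorial : ℝ)) * ∑ σ : Fin n → V, f σ * g σ / (X.degT σ : ℝ)

/-- The unweighted inner product `⟨f,g⟩ = Σ_{σ ∈ X^{n-1}} f(σ)g(σ)`. -/
def innerU [Fintype V] {n : ℕ} (f g : (Fin n → V) → ℝ) : ℝ :=
  (1 / (n.factorial : ℝ)) * ∑ σ : Fin n → V, f σ * g σ

/-- The norm induced by the weighted inner product. -/
def normW [Fintype V] {n : ℕ} (f : (Fin n → V) → ℝ) : ℝ :=
  Real.sqrt (X.innerW f f)

/-- `f` is a closed `(d-1)`-form (`f ∈ Z^{d-1} = ker ∂_d^*`), characterized by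
orthogonality to the image of `∂_d`. -/
def IsClosedForm [Fintype V] (m : ℕ) (f : (Fin (m + 2) → V) → ℝ) : Prop :=
  X.IsForm (m + 2) f ∧
  ∀ g : (Fin (m + 3) → V) → ℝ, X.IsForm (m + 3) g → X.innerW f (X.bdry g) = 0

/-- `f` is an exact `(d-1)`-form (`f ∈ B^{d-1} = im ∂_{d-1}^*`): `f = ∂_{d-1}^* g` for a
`(d-2)`-form `g`, characterized by the adjoint identity. -/
def IsExactForm [Fintype V] (m : ℕ) (f : (Fin (m + 2) → V) → ℝ) : Prop :=
  X.IsForm (m + 2) f ∧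
  ∃ g : (Fin (m + 1) → V) → ℝ, X.IsForm (m + 1) g ∧
    ∀ h : (Fin (m + 2) → V) → ℝ, X.IsForm (m + 2) h →
      X.innerW f h = innerU g (X.bdry h)

/-- Two tuples span the same oriented cell. -/
def SameOr {n : ℕ} (σ σ' : Fin n → V) : Prop :=
  ∃ π : Equiv.Perm (Fin n), Equiv.Perm.sign π = 1 ∧ σ' = σ ∘ π

/-- The neighbour relation on oriented `(d-1)`-cells: `σ ∼ σ'` iff there is an oriented
`d`-cell of which both `σ` and the reversal of `σ'` are faces with the induced
orientation; equivalently `σ' = (-1)^i v(σ∖σ_i)` for some `v ◁ σ`. -/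
def Nbr {n : ℕ} (σ σ' : Fin (n + 1) → V) : Prop :=
  ∃ (v : V) (i : Fin (n + 1)), X.IsCellT (Fin.cons v σ) ∧
    (if Even (i : ℕ) then SameOr σ' (Fin.cons v (σ ∘ i.succAbove))
     else SameOr σ' (Fin.cons v (σ ∘ i.succAbove) ∘ Equiv.swap 0 1))

/-- `σ` is a face of the oriented cell `τ` with the orientation induced by `τ`. -/
def IsInducedFace {n : ℕ} (σ : Fin (n + 1) → V) (τ : Fin (n + 2) → V) : Prop :=
  ∃ i : Fin (n + 2), if Even (i : ℕ) then SameOr σ (τ ∘ i.succAbove)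
    else SameOr σ (τ ∘ i.succAbove ∘ Equiv.swap 0 1)

/-- The family `𝒯` of `d`-cells (`d = m+2`) admits a disorientation: a choice of
orientation for each cell of `𝒯` such that any two of them sharing a
codimension-one face induce the same orientation on it. -/
def HasDisorientation (m : ℕ) (𝒯 : Set (Finset V)) : Prop :=
  ∃ c : Finset V → (Fin (m + 3) → V),
    (∀ t ∈ 𝒯, Function.Injective (c t) ∧ Finset.image (c t) Finset.univ = t) ∧
    ∀ t ∈ 𝒯, ∀ t' ∈ 𝒯, t ≠ t' → (t ∩ t').card = m + 2 →
      ∃ σ : Fin (m + 2) → V, Function.Injective σ ∧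
        Finset.image σ Finset.univ = t ∩ t' ∧
        IsInducedFace σ (c t) ∧ IsInducedFace σ (c t')

/-- `X` (of dimension `d`) has no simple `d`-loops: no non-backtracking closed chain
of `d`-cells in which consecutive cells share a `(d-1)`-cell. -/
def NoSimpleLoops (d : ℕ) : Prop :=
  ∀ (n : ℕ) (τ : ℕ → Finset V), 2 ≤ n → (∀ i, τ (i + n) = τ i) →
    (∀ i, τ i ∈ X.cells ∧ (τ i).card = d + 1) →
    (∀ i, (τ i ∩ τ (i + 1)) ∈ X.cells ∧ (τ i ∩ τ (i + 1)).card = d) →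
    (∀ i, τ i ≠ τ (i + 2)) → False

end SComplex

open SComplex

namespace SComplex

variable {V : Type*}

/-- A function on tuples which is antisymmetric under permutations. -/
def IsAlt {n : ℕ} (f : (Fin n → V) → ℝ) : Prop :=
  ∀ (σ : Fin n → V) (π : Equiv.Perm (Fin n)),
    f (σ ∘ π) = ((Equiv.Perm.sign π : ℤ) : ℝ) * f σ

/-- The simplicial coboundary of a function on tuples. -/
def cob {n : ℕ} (f : (Fin n → V) → ℝ) : (Fin (n + 1) → V) → ℝ := fun τ =>
  ∑ j : Fin (n + 1), (-1 : ℝ) ^ (j : ℕ) * f (τ ∘ j.succAbove)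

/-- The restriction of a function on tuples to the tuples spanning a cell. -/
def res (X : SComplex V) {n : ℕ} (f : (Fin n → V) → ℝ) : (Fin n → V) → ℝ := fun σ =>
  if X.IsCellT σ then f σ else 0

lemma sign_mul_sign_cast {n : ℕ} (π : Equiv.Perm (Fin n)) :
    ((Equiv.Perm.sign π : ℤ) : ℝ) * ((Equiv.Perm.sign π : ℤ) : ℝ) = 1 := by
  rcases Int.units_eq_one_or (Equiv.Perm.sign π) with h | h <;> simp [h]

lemma exists_perm_succAbove {n : ℕ} (π : Equiv.Perm (Fin (n + 1))) (j : Fin (n + 1)) :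
    ∃ e : Equiv.Perm (Fin n), (∀ i, π (j.succAbove i) = (π j).succAbove (e i)) ∧
      ((Equiv.Perm.sign e : ℤ) : ℝ) =
        (-1) ^ (j : ℕ) * (-1) ^ (π j : ℕ) * ((Equiv.Perm.sign π : ℤ) : ℝ) := by
  obtain ⟨⟨q, e⟩, h⟩ := Equiv.Perm.decomposeFin.symm.surjective
    ((π j).cycleRange * π * j.cycleRange⁻¹)
  have hinv : ∀ x, j.cycleRange⁻¹ x = j.cycleRange.symm x := fun _ => rfl
  have hq : q = 0 := by
    have := congrArg (fun ρ : Equiv.Perm (Fin (n + 1)) => ρ 0) h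
    simpa [hinv] using this
  subst hq
  refine ⟨e, fun i => ?_, ?_⟩
  · have := congrArg (fun ρ : Equiv.Perm (Fin (n + 1)) => ρ i.succ) h
    simp only [Equiv.Perm.decomposeFin_symm_apply_succ, Equiv.swap_self, Equiv.refl_apply,
      Equiv.Perm.mul_apply, hinv, Fin.cycleRange_symm_succ] at this
    rw [← Fin.cycleRange_symm_succ (π j) (e i), this, Equiv.symm_apply_apply]
  · have := congrArg (fun ρ : Equiv.Perm (Fin (n + 1)) => ((Equiv.Perm.sign ρ : ℤ) : ℝ)) h
    simp only [Equiv.Perm.decomposeFin.symm_sign, Equiv.Perm.sign_mul, Equiv.Perm.sign_inv,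
      Fin.sign_cycleRange] at this
    push_cast at this
    linarith

lemma IsAlt.cob {n : ℕ} {f : (Fin n → V) → ℝ} (hf : IsAlt f) : IsAlt (cob f) := by
  intro τ π
  unfold SComplex.cob
  rw [Finset.mul_sum, ← Equiv.sum_comp π (fun i => ((Equiv.Perm.sign π : ℤ) : ℝ) *
    ((-1 : ℝ) ^ (i : ℕ) * f (τ ∘ i.succAbove)))]
  refine Finset.sum_congr rfl fun j _ => ?_
  obtain ⟨e, he, hs⟩ := exists_perm_succAbove π j
  have : (τ ∘ π) ∘ j.succAbove = (τ ∘ (π j).succAbove) ∘ e := by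
    funext i
    simp [he]
  rw [this, hf, hs]
  have h1 : ((-1 : ℝ) ^ (j : ℕ)) * (-1) ^ (j : ℕ) = 1 := by
    rw [← mul_pow]; simp
  linear_combination ((-1) ^ (π j : ℕ) * ((Equiv.Perm.sign π : ℤ) : ℝ) *
    f (τ ∘ (π j).succAbove)) * h1

/-- The coboundary squares to zero. -/
lemma cob_cob {n : ℕ} (f : (Fin n → V) → ℝ) (τ : Fin (n + 2) → V) : cob (cob f) τ = 0 := by
  unfold SComplex.cob
  simp only [Finset.mul_sum]
  rw [← Finset.sum_product']
  refine Finset.sum_involution (fun a _ => (a.1.succAbove a.2, a.2.predAbove a.1)) ?_ ?_ ?_ ?_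
  · rintro ⟨i, j⟩ -
    have h : (τ ∘ (i.succAbove j).succAbove) ∘ (j.predAbove i).succAbove =
        (τ ∘ i.succAbove) ∘ j.succAbove := by
      funext k
      simp [Fin.succAbove_succAbove_succAbove_predAbove]
    have hs := Fin.neg_one_pow_succAbove_add_predAbove (R := ℝ) i j
    simp only [h]
    rw [pow_add, pow_add] at hs
    linear_combination (f ((τ ∘ i.succAbove) ∘ j.succAbove)) * hs
  · rintro ⟨i, j⟩ - - h
    exact Fin.succAbove_ne i j (congrArg Prod.fst h)
  · intros; simp
  · rintro ⟨i, j⟩ -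
    ext1
    · exact Fin.succAbove_succAbove_predAbove i j
    · exact Fin.predAbove_predAbove_succAbove i j

lemma image_comp_perm {n : ℕ} (σ : Fin n → V) (π : Equiv.Perm (Fin n)) :
    Finset.image (σ ∘ π) Finset.univ = Finset.image σ Finset.univ := by
  ext x
  simp only [Finset.mem_image, Finset.mem_univ, true_and, Function.comp]
  exact (π.surjective.exists (p := fun a => σ a = x)).symm

lemma isCellT_comp_perm (X : SComplex V) {n : ℕ} (σ : Fin n → V) (π : Equiv.Perm (Fin n)) :
    X.IsCellT (σ ∘ π) ↔ X.IsCellT σ := by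
  unfold IsCellT
  rw [image_comp_perm]
  simp

lemma degT_comp_perm (X : SComplex V) {n : ℕ} (σ : Fin n → V) (π : Equiv.Perm (Fin n)) :
    X.degT (σ ∘ π) = X.degT σ := by
  unfold degT
  rw [image_comp_perm]

lemma IsAlt.res {n : ℕ} {f : (Fin n → V) → ℝ} (hf : IsAlt f) (X : SComplex V) :
    IsAlt (X.res f) := by
  intro σ π
  unfold SComplex.res
  rw [isCellT_comp_perm, hf]
  simp

lemma IsCellT.face {X : SComplex V} {n : ℕ} {τ : Fin (n + 2) → V} (h : X.IsCellT τ)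
    (j : Fin (n + 2)) : X.IsCellT (τ ∘ j.succAbove) := by
  refine ⟨h.1.comp Fin.succAbove_right_injective, X.down_closed h.2 ?_ (by simp)⟩
  intro x hx
  simp only [Finset.mem_image, Finset.mem_univ, true_and, Function.comp] at hx ⊢
  obtain ⟨i, rfl⟩ := hx
  exact ⟨_, rfl⟩

lemma sum_face_mul [Fintype V] {n : ℕ} (H : (Fin n → V) → ℝ) (K : (Fin (n + 1) → V) → ℝ)
    (j : Fin (n + 1)) :
    ∑ τ : Fin (n + 1) → V, H (τ ∘ j.succAbove) * K τ =
      ∑ τ : Fin (n + 1) → V, H (τ ∘ Fin.succ) * K (τ ∘ j.cycleRange) := by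
  refine Fintype.sum_equiv (Equiv.arrowCongr j.cycleRange (Equiv.refl V)) _ _ fun τ => ?_
  have h1 : (Equiv.arrowCongr j.cycleRange (Equiv.refl V) τ) ∘ Fin.succ = τ ∘ j.succAbove := by
    funext i
    simp [Equiv.arrowCongr]
  have h2 : (Equiv.arrowCongr j.cycleRange (Equiv.refl V) τ) ∘ j.cycleRange = τ := by
    funext i
    simp [Equiv.arrowCongr]
  rw [h1, h2]

lemma sum_tuple_succ [Fintype V] {n : ℕ} (H : (Fin n → V) → ℝ) (K : (Fin (n + 1) → V) → ℝ) :
    ∑ τ : Fin (n + 1) → V, H (τ ∘ Fin.succ) * K τ =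
      ∑ σ : Fin n → V, H σ * ∑ v : V, K (Fin.cons v σ) := by
  rw [← Equiv.sum_comp (Fin.consEquiv (fun _ : Fin (n + 1) => V)), Fintype.sum_prod_type_right]
  refine Finset.sum_congr rfl fun σ _ => ?_
  rw [Finset.mul_sum]
  refine Finset.sum_congr rfl fun v _ => ?_
  simp only [Fin.consEquiv, Equiv.coe_fn_mk]
  congr 1

/-- Summation by parts for the coboundary against an antisymmetric function. -/
lemma sum_cob_mul [Fintype V] {n : ℕ} (f : (Fin n → V) → ℝ) {G : (Fin (n + 1) → V) → ℝ}
    (hG : IsAlt G) :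
    ∑ τ : Fin (n + 1) → V, cob f τ * G τ =
      ((n : ℝ) + 1) * ∑ σ : Fin n → V, f σ * ∑ v : V, G (Fin.cons v σ) := by
  unfold cob
  simp only [Finset.sum_mul, mul_assoc]
  rw [Finset.sum_comm]
  have : ∀ j ∈ (Finset.univ : Finset (Fin (n + 1))),
      ∑ τ : Fin (n + 1) → V, (-1 : ℝ) ^ (j : ℕ) * (f (τ ∘ j.succAbove) * G τ) =
      ∑ σ : Fin n → V, f σ * ∑ v : V, G (Fin.cons v σ) := by
    intro j _
    rw [← Finset.mul_sum, sum_face_mul, ← sum_tuple_succ, Finset.mul_sum]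
    refine Finset.sum_congr rfl fun τ _ => ?_
    rw [hG, Fin.sign_cycleRange]
    push_cast
    have h1 : ((-1 : ℝ) ^ (j : ℕ)) * (-1) ^ (j : ℕ) = 1 := by
      rw [← mul_pow]; simp
    linear_combination (f (τ ∘ Fin.succ) * G τ) * h1
  rw [Finset.sum_congr rfl this]
  simp

lemma image_cons {n : ℕ} (v : V) (σ : Fin n → V) :
    Finset.image (Fin.cons v σ : Fin (n + 1) → V) Finset.univ =
      insert v (Finset.image σ Finset.univ) := by
  ext x
  simp [Fin.exists_fin_succ, eq_comm]

lemma isCellT_of_cons {X : SComplex V} {n : ℕ} {v : V} {σ : Fin (n + 1) → V}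
    (h : X.IsCellT (Fin.cons v σ : Fin (n + 2) → V)) : X.IsCellT σ :=
  h.face 0

/-- The number of vertices extending a cell to a larger cell is the degree of the cell. -/
lemma sum_cell_cons [Fintype V] (X : SComplex V) {n : ℕ} {σ : Fin n → V} (h : X.IsCellT σ) :
    ∑ v : V, (if X.IsCellT (Fin.cons v σ : Fin (n + 1) → V) then (1 : ℝ) else 0) =
      X.degT σ := by
  have hiff : ∀ v : V, X.IsCellT (Fin.cons v σ : Fin (n + 1) → V) ↔
      v ∉ Finset.image σ Finset.univ ∧ insert v (Finset.image σ Finset.univ) ∈ X.cells := by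
    intro v
    unfold IsCellT
    rw [Fin.cons_injective_iff, image_cons]
    simp [h.1]
  have hset : {t : Finset V | t ∈ X.cells ∧
      t.card = (Finset.image σ Finset.univ).card + 1 ∧ Finset.image σ Finset.univ ⊆ t} =
      (fun v => insert v (Finset.image σ Finset.univ)) ''
        {v : V | X.IsCellT (Fin.cons v σ : Fin (n + 1) → V)} := by
    ext t
    simp only [Set.mem_ofPred_eq, Set.mem_image, hiff]
    constructor
    · rintro ⟨ht, hc, hs⟩
      obtain ⟨v, hv, rfl⟩ := (Finset.covBy_iff_exists_insert.1
        (Finset.covBy_iff_card_sdiff_eq_one.2 ⟨hs, by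
          rw [Finset.card_sdiff_of_subset hs]; omega⟩))
      exact ⟨v, ⟨hv, ht⟩, rfl⟩
    · rintro ⟨v, ⟨hv, ht⟩, rfl⟩
      exact ⟨ht, Finset.card_insert_of_notMem hv, Finset.subset_insert _ _⟩
  rw [degT, degS, hset, Set.InjOn.ncard_image, Set.ncard_eq_toFinset_card']
  · rw [Finset.sum_boole]
    congr 2
    ext v
    simp
  · intro v hv w hw hvw
    simp only [Set.mem_ofPred_eq, hiff] at hv hw
    have : v ∈ insert w (Finset.image σ Finset.univ) := by
      rw [← show insert v _ = insert w _ from hvw]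
      exact Finset.mem_insert_self _ _
    rcases Finset.mem_insert.1 this with h' | h'
    · exact h'
    · exact absurd h' hv.1

lemma nbrW_eq_sum [Fintype V] (X : SComplex V) {n : ℕ} (f : (Fin (n + 1) → V) → ℝ)
    (σ : Fin (n + 1) → V) :
    X.nbrW f σ = ∑ v : V, if X.IsCellT (Fin.cons v σ : Fin (n + 2) → V) then
      ∑ i : Fin (n + 1), (-1 : ℝ) ^ (i : ℕ) * f (Fin.cons v (σ ∘ i.succAbove)) /
        (X.degT (Fin.cons v (σ ∘ i.succAbove)) : ℝ) else 0 := by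
  unfold nbrW
  rw [finsum_mem_def, finsum_eq_sum_of_fintype]
  simp only [Set.indicator_apply, Set.mem_ofPred_eq]

lemma nbrW_add_smul [Fintype V] (X : SComplex V) {n : ℕ} (f g : (Fin (n + 1) → V) → ℝ) (c : ℝ) :
    X.nbrW (f + c • g) = X.nbrW f + c • X.nbrW g := by
  funext σ
  simp only [Pi.add_apply, Pi.smul_apply, smul_eq_mul, nbrW_eq_sum]
  rw [Finset.mul_sum, ← Finset.sum_add_distrib]
  refine Finset.sum_congr rfl fun v _ => ?_
  split_ifs
  · rw [Finset.mul_sum, ← Finset.sum_add_distrib]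
    refine Finset.sum_congr rfl fun i _ => ?_
    ring
  · simp

lemma transOp_add_smul [Fintype V] (X : SComplex V) {n : ℕ} (p : ℝ)
    (f g : (Fin (n + 1) → V) → ℝ) (c : ℝ) :
    X.transOp p (f + c • g) = X.transOp p f + c • X.transOp p g := by
  funext σ
  simp only [transOp, nbrW_add_smul, Pi.add_apply, Pi.smul_apply, smul_eq_mul]
  ring

lemma cob_cons {n : ℕ} (f : (Fin (n + 1) → V) → ℝ) (v : V) (σ : Fin (n + 1) → V) :
    cob f (Fin.cons v σ) =
      f σ - ∑ i : Fin (n + 1), (-1 : ℝ) ^ (i : ℕ) * f (Fin.cons v (σ ∘ i.succAbove)) := by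
  unfold cob
  rw [Fin.sum_univ_succ]
  have h0 : (Fin.cons v σ : Fin (n + 2) → V) ∘ Fin.succAbove 0 = σ := by
    funext i; simp
  have hs : ∀ i : Fin (n + 1), (Fin.cons v σ : Fin (n + 2) → V) ∘ i.succ.succAbove =
      Fin.cons v (σ ∘ i.succAbove) := by
    intro i
    funext k
    refine Fin.cases ?_ (fun k => ?_) k <;> simp
  rw [h0, sub_eq_add_neg, ← Finset.sum_neg_distrib]
  congr 1
  · simp
  · refine Finset.sum_congr rfl fun i _ => ?_
    rw [hs, Fin.val_succ, pow_succ]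
    ring

lemma IsAlt.sum_cons [Fintype V] {n : ℕ} {G : (Fin (n + 1) → V) → ℝ} (hG : IsAlt G) :
    IsAlt (fun σ : Fin n → V => ∑ v : V, G (Fin.cons v σ)) := by
  intro σ π
  simp only
  rw [Finset.mul_sum]
  refine Finset.sum_congr rfl fun v _ => ?_
  have h : (Fin.cons v (σ ∘ π) : Fin (n + 1) → V) =
      (Fin.cons v σ : Fin (n + 1) → V) ∘ (Equiv.Perm.decomposeFin.symm (0, π)) := by
    funext k
    refine Fin.cases ?_ (fun k => ?_) k <;> simp
  rw [h, hG]
  simp [Equiv.Perm.decomposeFin.symm_sign]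

/-- The coboundary of the form `f / deg`, restricted to the cells of `X`. -/
def wcob (X : SComplex V) {n : ℕ} (f : (Fin n → V) → ℝ) : (Fin (n + 1) → V) → ℝ :=
  X.res (cob fun σ => f σ / (X.degT σ : ℝ))

lemma IsAlt.div_degT {n : ℕ} {f : (Fin n → V) → ℝ} (hf : IsAlt f) (X : SComplex V) :
    IsAlt (fun σ => f σ / (X.degT σ : ℝ)) := by
  intro σ π
  simp only
  rw [degT_comp_perm, hf]
  ring

lemma IsAlt.wcob {n : ℕ} {f : (Fin n → V) → ℝ} (hf : IsAlt f) (X : SComplex V) :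
    IsAlt (X.wcob f) :=
  ((hf.div_degT X).cob).res X

lemma IsForm.add_smul {X : SComplex V} {n : ℕ} {f g : (Fin n → V) → ℝ} (hf : X.IsForm n f) (hg : X.IsForm n g)
    (c : ℝ) : X.IsForm n (f + c • g) := by
  refine ⟨fun σ h => by simp [hf.1 σ h, hg.1 σ h], fun σ π => ?_⟩
  simp only [Pi.add_apply, Pi.smul_apply, smul_eq_mul, hf.2, hg.2]
  ring

section Forms

variable [Fintype V] {X : SComplex V} {n : ℕ}

lemma sum_wcob_cons (hpos : ∀ σ : Fin (n + 1) → V, X.IsCellT σ → 0 < X.degT σ)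
    {f : (Fin (n + 1) → V) → ℝ} (hf : X.IsForm (n + 1) f) (σ : Fin (n + 1) → V) :
    ∑ v : V, X.wcob f (Fin.cons v σ) = f σ - X.nbrW f σ := by
  have hfirst : f σ = ∑ v : V,
      (if X.IsCellT (Fin.cons v σ : Fin (n + 2) → V) then f σ / (X.degT σ : ℝ) else 0) := by
    by_cases h : X.IsCellT σ
    · have h1 : (X.degT σ : ℝ) ≠ 0 := by exact_mod_cast (hpos σ h).ne'
      have h2 := sum_cell_cons X h
      calc f σ = f σ / (X.degT σ : ℝ) * (X.degT σ : ℝ) := by field_simp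
        _ = _ := by
          rw [← h2, Finset.mul_sum]
          refine Finset.sum_congr rfl fun v _ => ?_
          simp [h2]
    · simp [hf.1 σ h]
  rw [nbrW_eq_sum]
  conv_rhs => rw [hfirst]
  rw [← Finset.sum_sub_distrib]
  refine Finset.sum_congr rfl fun v _ => ?_
  unfold wcob res
  split_ifs
  · rw [cob_cons]
    simp only [mul_div_assoc]
  · simp

lemma IsForm.transOp (hpos : ∀ σ : Fin (n + 1) → V, X.IsCellT σ → 0 < X.degT σ)
    {f : (Fin (n + 1) → V) → ℝ} (hf : X.IsForm (n + 1) f) (p : ℝ) :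
    X.IsForm (n + 1) (X.transOp p f) := by
  have hn : ∀ σ, X.nbrW f σ = f σ - ∑ v : V, X.wcob f (Fin.cons v σ) := by
    intro σ
    rw [sum_wcob_cons hpos hf]
    ring
  have halt := (IsAlt.wcob (f := f) hf.2 X).sum_cons
  refine ⟨fun σ h => ?_, fun σ π => ?_⟩
  · have : X.nbrW f σ = 0 := by
      rw [nbrW_eq_sum]
      exact Finset.sum_eq_zero fun v _ => if_neg fun hc => h (isCellT_of_cons hc)
    simp [SComplex.transOp, hf.1 σ h, this]
  · have := halt σ π
    simp only at this
    simp only [SComplex.transOp, hn, this, hf.2]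
    ring

lemma IsForm.iterate_transOp (hpos : ∀ σ : Fin (n + 1) → V, X.IsCellT σ → 0 < X.degT σ)
    {f : (Fin (n + 1) → V) → ℝ} (hf : X.IsForm (n + 1) f) (p : ℝ) (k : ℕ) :
    X.IsForm (n + 1) ((X.transOp p)^[k] f) := by
  induction k with
  | zero => exact hf
  | succ k ih =>
    rw [Function.iterate_succ_apply']
    exact ih.transOp hpos p

lemma innerW_comm (f g : (Fin n → V) → ℝ) : X.innerW f g = X.innerW g f := by
  unfold innerW
  simp only [mul_comm]

lemma innerW_add_smul_left (f g h : (Fin n → V) → ℝ) (c : ℝ) :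
    X.innerW (f + c • g) h = X.innerW f h + c * X.innerW g h := by
  unfold innerW
  have : ∀ σ : Fin n → V, (f + c • g) σ * h σ / (X.degT σ : ℝ) =
      f σ * h σ / (X.degT σ : ℝ) + c * (g σ * h σ / (X.degT σ : ℝ)) := by
    intro σ
    simp only [Pi.add_apply, Pi.smul_apply, smul_eq_mul]
    ring
  simp only [this, Finset.sum_add_distrib, ← Finset.mul_sum]
  ring

lemma innerW_add_smul_right (f g h : (Fin n → V) → ℝ) (c : ℝ) :
    X.innerW h (f + c • g) = X.innerW h f + c * X.innerW h g := by
  rw [innerW_comm, innerW_add_smul_left, innerW_comm f, innerW_comm g]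

lemma innerW_self_nonneg (f : (Fin n → V) → ℝ) : 0 ≤ X.innerW f f := by
  unfold innerW
  refine mul_nonneg (by positivity) (Finset.sum_nonneg fun σ _ => ?_)
  exact div_nonneg (mul_self_nonneg _) (Nat.cast_nonneg _)

/-- The Cauchy–Schwarz inequality for the weighted inner product. -/
lemma innerW_sq_le (f g : (Fin n → V) → ℝ) :
    X.innerW f g ^ 2 ≤ X.innerW f f * X.innerW g g := by
  unfold innerW
  have h := Finset.sum_sq_le_sum_mul_sum_of_sq_le_mul (Finset.univ : Finset (Fin n → V))
    (r := fun σ => f σ * g σ / (X.degT σ : ℝ)) (f := fun σ => f σ * f σ / (X.degT σ : ℝ))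
    (g := fun σ => g σ * g σ / (X.degT σ : ℝ))
    (fun σ _ => div_nonneg (mul_self_nonneg _) (Nat.cast_nonneg _))
    (fun σ _ => div_nonneg (mul_self_nonneg _) (Nat.cast_nonneg _))
    (fun σ _ => le_of_eq (by ring))
  have h2 := mul_le_mul_of_nonneg_left h (sq_nonneg (1 / (n.factorial : ℝ)))
  calc _ = (1 / (n.factorial : ℝ)) ^ 2 * (∑ σ : Fin n → V, f σ * g σ / (X.degT σ : ℝ)) ^ 2 := by
        ring
    _ ≤ _ := h2
    _ = _ := by ring

/-- The Dirichlet form of the upper Laplacian. -/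
def dirichlet (X : SComplex V) (f g : (Fin (n + 1) → V) → ℝ) : ℝ :=
  (1 / ((n + 1).factorial : ℝ)) * ∑ τ : Fin (n + 2) → V, X.wcob f τ * X.wcob g τ

lemma dirichlet_comm (f g : (Fin (n + 1) → V) → ℝ) : X.dirichlet f g = X.dirichlet g f := by
  unfold dirichlet
  simp only [mul_comm]

lemma dirichlet_self_nonneg (f : (Fin (n + 1) → V) → ℝ) : 0 ≤ X.dirichlet f f :=
  mul_nonneg (by positivity) (Finset.sum_nonneg fun _ _ => mul_self_nonneg _)

lemma mul_innerW_nbrW (hpos : ∀ σ : Fin (n + 1) → V, X.IsCellT σ → 0 < X.degT σ)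
    {g : (Fin (n + 1) → V) → ℝ} (hg : X.IsForm (n + 1) g) (f : (Fin (n + 1) → V) → ℝ) :
    ((n : ℝ) + 2) * (X.innerW f g - X.innerW f (X.nbrW g)) = X.dirichlet f g := by
  have h1 : ∑ τ : Fin (n + 2) → V, X.wcob f τ * X.wcob g τ =
      ∑ τ : Fin (n + 2) → V, cob (fun σ => f σ / (X.degT σ : ℝ)) τ * X.wcob g τ := by
    refine Finset.sum_congr rfl fun τ _ => ?_
    unfold wcob res
    split_ifs <;> simp
  unfold dirichlet innerW
  rw [h1, sum_cob_mul _ (IsAlt.wcob hg.2 X), ← mul_sub, ← Finset.sum_sub_distrib]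
  simp only [sum_wcob_cons hpos hg]
  push_cast
  rw [mul_left_comm, show (n : ℝ) + 1 + 1 = n + 2 by ring]
  congr 2
  refine Finset.sum_congr rfl fun σ _ => ?_
  ring

lemma innerW_transOp (hpos : ∀ σ : Fin (n + 1) → V, X.IsCellT σ → 0 < X.degT σ)
    {f : (Fin (n + 1) → V) → ℝ} (hf : X.IsForm (n + 1) f) (g : (Fin (n + 1) → V) → ℝ) (p : ℝ) :
    X.innerW (X.transOp p f) g = (p + (1 - p) / ((n : ℝ) + 1)) * X.innerW f g -
      (1 - p) / ((n : ℝ) + 1) / ((n : ℝ) + 2) * X.dirichlet f g := by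
  have h1 : X.transOp p f = f + (1 : ℝ) • ((p - 1) • f) +
      ((1 - p) / ((n : ℝ) + 1)) • X.nbrW f := by
    funext σ
    simp only [transOp, Pi.add_apply, Pi.smul_apply, smul_eq_mul]
    ring
  have h2 : (p - 1) • f = 0 + (p - 1) • f := by simp
  have h3 : X.innerW 0 g = 0 := by simp [innerW]
  rw [h1, innerW_add_smul_left, innerW_add_smul_left, h2, innerW_add_smul_left, h3,
    dirichlet_comm, ← mul_innerW_nbrW hpos hf g, innerW_comm g, innerW_comm g]
  have : (n : ℝ) + 2 ≠ 0 := by positivity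
  field_simp
  ring

lemma dirichlet_self_le (hpos : ∀ σ : Fin (n + 1) → V, X.IsCellT σ → 0 < X.degT σ)
    {f : (Fin (n + 1) → V) → ℝ} (hf : X.IsForm (n + 1) f) :
    X.dirichlet f f ≤ ((n : ℝ) + 2) ^ 2 * X.innerW f f := by
  set F : (Fin (n + 1) → V) → ℝ := fun σ => f σ / (X.degT σ : ℝ) with hF
  set I : (Fin (n + 2) → V) → ℝ := fun τ => if X.IsCellT τ then 1 else 0 with hI
  have hle : ∀ τ : Fin (n + 2) → V, X.wcob f τ * X.wcob f τ ≤
      ((n : ℝ) + 2) * ∑ j : Fin (n + 2), F (τ ∘ j.succAbove) ^ 2 * I τ := by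
    intro τ
    unfold wcob res
    by_cases h : X.IsCellT τ
    · simp only [h, if_true, hI, mul_one]
      have := sq_sum_le_card_mul_sum_sq (s := (Finset.univ : Finset (Fin (n + 2))))
        (f := fun j => (-1 : ℝ) ^ (j : ℕ) * F (τ ∘ j.succAbove))
      rw [← sq]
      refine this.trans (le_of_eq ?_)
      simp only [Finset.card_univ, Fintype.card_fin]
      push_cast
      congr 1
      refine Finset.sum_congr rfl fun j _ => ?_
      rw [mul_pow, ← pow_mul, mul_comm _ 2, pow_mul]
      simp
    · simp [h, hI]
  have hsum : ∀ j : Fin (n + 2), ∑ τ : Fin (n + 2) → V, F (τ ∘ j.succAbove) ^ 2 * I τ =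
      ∑ σ : Fin (n + 1) → V, f σ * f σ / (X.degT σ : ℝ) := by
    intro j
    rw [sum_face_mul (fun σ => F σ ^ 2) I j]
    have hc : ∀ τ, I (τ ∘ j.cycleRange) = I τ := by
      intro τ
      simp only [hI, isCellT_comp_perm]
    simp only [hc]
    rw [sum_tuple_succ (fun σ => F σ ^ 2)]
    refine Finset.sum_congr rfl fun σ _ => ?_
    by_cases h : X.IsCellT σ
    · have h1 : (X.degT σ : ℝ) ≠ 0 := by exact_mod_cast (hpos σ h).ne'
      simp only [hI, hF, sum_cell_cons X h]
      field_simp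
    · simp [hF, hf.1 σ h]
  unfold dirichlet innerW
  rw [mul_left_comm]
  refine mul_le_mul_of_nonneg_left ?_ (by positivity)
  refine (Finset.sum_le_sum fun τ _ => hle τ).trans (le_of_eq ?_)
  rw [← Finset.mul_sum, Finset.sum_comm, Finset.sum_congr rfl fun j _ => hsum j]
  simp only [Finset.sum_const, Finset.card_univ, Fintype.card_fin, nsmul_eq_mul]
  push_cast
  ring

lemma innerW_transOp_self_bounds (hpos : ∀ σ : Fin (n + 1) → V, X.IsCellT σ → 0 < X.degT σ)
    {f : (Fin (n + 1) → V) → ℝ} (hf : X.IsForm (n + 1) f) {p M : ℝ} (hp : p ≤ 1)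
    (hM₁ : |2 * p - 1| ≤ M) (hM₂ : p + (1 - p) / ((n : ℝ) + 1) ≤ M) :
    X.innerW (X.transOp p f) f ≤ M * X.innerW f f ∧
      -(M * X.innerW f f) ≤ X.innerW (X.transOp p f) f := by
  have h0 := innerW_self_nonneg (X := X) f
  have hd := dirichlet_self_nonneg (X := X) f
  have hd' := dirichlet_self_le hpos hf
  have hq : 0 ≤ (1 - p) / ((n : ℝ) + 1) / ((n : ℝ) + 2) := by
    have : 0 ≤ 1 - p := by linarith
    positivity
  rw [innerW_transOp hpos hf]
  constructor
  · have h1 := mul_le_mul_of_nonneg_right hM₂ h0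
    have h2 := mul_nonneg hq hd
    linarith
  · have h1 := mul_le_mul_of_nonneg_left hd' hq
    have h2 : (1 - p) / ((n : ℝ) + 1) / ((n : ℝ) + 2) * (((n : ℝ) + 2) ^ 2 * X.innerW f f) =
        (1 - p) * X.innerW f f + (1 - p) / ((n : ℝ) + 1) * X.innerW f f := by
      field_simp
      ring
    have h3 := mul_le_mul_of_nonneg_right ((neg_le_neg hM₁).trans (neg_abs_le (2 * p - 1))) h0
    rw [h2] at h1
    linarith

/-- The numerical range of the self-adjoint operator `transOp` bounds its norm. -/
lemma innerW_transOp_transOp_le (hpos : ∀ σ : Fin (n + 1) → V, X.IsCellT σ → 0 < X.degT σ)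
    {f : (Fin (n + 1) → V) → ℝ} (hf : X.IsForm (n + 1) f) {p M : ℝ} (hp : p ≤ 1) (hM : 0 < M)
    (hM₁ : |2 * p - 1| ≤ M) (hM₂ : p + (1 - p) / ((n : ℝ) + 1) ≤ M) :
    X.innerW (X.transOp p f) (X.transOp p f) ≤ M ^ 2 * X.innerW f f := by
  set g := X.transOp p f with hg
  have hgf : X.IsForm (n + 1) g := hf.transOp hpos p
  have h1 := (innerW_transOp_self_bounds hpos (hf.add_smul hgf M⁻¹) hp hM₁ hM₂).1
  have h2 := (innerW_transOp_self_bounds hpos (hf.add_smul hgf (-M⁻¹)) hp hM₁ hM₂).2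
  have hsymm : X.innerW (X.transOp p g) f = X.innerW g g := by
    rw [innerW_transOp hpos hgf, dirichlet_comm, innerW_comm g f]
    exact (innerW_transOp hpos hf g p).symm
  simp only [transOp_add_smul, innerW_add_smul_left, innerW_add_smul_right, ← hg, hsymm] at h1 h2
  have h3 : 4 * M⁻¹ * X.innerW g g ≤ 2 * M * X.innerW f f + 2 * (M * M⁻¹) * M⁻¹ * X.innerW g g := by
    linarith
  rw [mul_inv_cancel₀ hM.ne'] at h3
  have h4 : M⁻¹ * X.innerW g g ≤ M * X.innerW f f := by linarith
  rw [inv_mul_le_iff₀ hM] at h4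
  linarith

lemma normW_iterate_transOp_le (hpos : ∀ σ : Fin (n + 1) → V, X.IsCellT σ → 0 < X.degT σ)
    {f : (Fin (n + 1) → V) → ℝ} (hf : X.IsForm (n + 1) f) {p M : ℝ} (hp : p ≤ 1) (hM : 0 < M)
    (hM₁ : |2 * p - 1| ≤ M) (hM₂ : p + (1 - p) / ((n : ℝ) + 1) ≤ M) (k : ℕ) :
    X.normW ((X.transOp p)^[k] f) ≤ M ^ k * X.normW f := by
  induction k with
  | zero => simp
  | succ k ih =>
    rw [Function.iterate_succ_apply', pow_succ', mul_assoc]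
    refine le_trans ?_ (mul_le_mul_of_nonneg_left ih hM.le)
    have h := innerW_transOp_transOp_le hpos (hf.iterate_transOp hpos p k) hp hM hM₁ hM₂
    unfold normW
    refine (Real.sqrt_le_sqrt h).trans (le_of_eq ?_)
    rw [Real.sqrt_mul (sq_nonneg M), Real.sqrt_sq hM.le]

end Forms

section Dirac

variable {n : ℕ}

lemma dirac_eq_sum {σ₀ : Fin n → V} (h : Function.Injective σ₀) (σ : Fin n → V) :
    dirac σ₀ σ = ∑ π : Equiv.Perm (Fin n),
      if σ = σ₀ ∘ π then ((Equiv.Perm.sign π : ℤ) : ℝ) else 0 := by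
  by_cases hσ : ∃ π : Equiv.Perm (Fin n), σ = σ₀ ∘ π
  · obtain ⟨ρ, rfl⟩ := hσ
    have hinj : ∀ π : Equiv.Perm (Fin n), σ₀ ∘ ρ = σ₀ ∘ π ↔ π = ρ := by
      intro π
      constructor
      · intro he
        ext1 i
        exact (h (congrFun he i)).symm
      · rintro rfl; rfl
    simp only [hinj, Finset.sum_ite_eq', Finset.mem_univ, if_true, dirac, exists_eq_right]
    rcases Int.units_eq_one_or (Equiv.Perm.sign ρ) with hs | hs <;> simp [hs]
  · have h' : ∀ π : Equiv.Perm (Fin n), σ ≠ σ₀ ∘ π := fun π he => hσ ⟨π, he⟩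
    simp [dirac, h']

lemma dirac_self {σ₀ : Fin n → V} : dirac σ₀ σ₀ = 1 := by
  unfold dirac
  rw [if_pos ⟨1, by simp, rfl⟩]

lemma dirac_eq_zero {σ₀ σ : Fin n → V} (h : ∀ π : Equiv.Perm (Fin n), σ ≠ σ₀ ∘ π) :
    dirac σ₀ σ = 0 := by
  simp [dirac, h]

lemma isAlt_dirac {σ₀ : Fin n → V} (h : Function.Injective σ₀) : IsAlt (dirac σ₀) := by
  intro σ ρ
  rw [dirac_eq_sum h, dirac_eq_sum h, Finset.mul_sum, ← Equiv.sum_comp (Equiv.mulRight ρ)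
    (fun π : Equiv.Perm (Fin n) =>
      if σ ∘ ρ = σ₀ ∘ π then ((Equiv.Perm.sign π : ℤ) : ℝ) else 0)]
  refine Finset.sum_congr rfl fun π _ => ?_
  have hiff : σ ∘ ρ = σ₀ ∘ (Equiv.mulRight ρ π : Equiv.Perm (Fin n)) ↔ σ = σ₀ ∘ π := by
    constructor
    · intro he
      funext i
      simpa using congrFun he (ρ.symm i)
    · rintro rfl; rfl
  simp only [hiff]
  split_ifs
  · simp [Equiv.Perm.sign_mul, mul_comm]
  · simp

lemma isForm_dirac {X : SComplex V} {σ₀ : Fin n → V} (h : X.IsCellT σ₀) :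
    X.IsForm n (dirac σ₀) := by
  refine ⟨fun σ hσ => dirac_eq_zero ?_, isAlt_dirac h.1⟩
  rintro π rfl
  exact hσ ((isCellT_comp_perm X σ₀ π).2 h)

lemma sum_dirac_mul [Fintype V] {σ₀ : Fin n → V} (h : Function.Injective σ₀)
    {g : (Fin n → V) → ℝ} (hg : IsAlt g) :
    ∑ σ : Fin n → V, dirac σ₀ σ * g σ = (n.factorial : ℝ) * g σ₀ := by
  simp only [dirac_eq_sum h, Finset.sum_mul]
  rw [Finset.sum_comm]
  have : ∀ π ∈ (Finset.univ : Finset (Equiv.Perm (Fin n))), ∑ σ : Fin n → V,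
      (if σ = σ₀ ∘ π then ((Equiv.Perm.sign π : ℤ) : ℝ) else 0) * g σ = g σ₀ := by
    intro π _
    simp only [ite_mul, zero_mul, Finset.sum_ite_eq', Finset.mem_univ, if_true]
    rw [hg, ← mul_assoc, sign_mul_sign_cast, one_mul]
  rw [Finset.sum_congr rfl this]
  simp [Fintype.card_perm]

lemma innerW_dirac [Fintype V] (X : SComplex V) {σ₀ : Fin n → V} (h : Function.Injective σ₀)
    {g : (Fin n → V) → ℝ} (hg : IsAlt g) :
    X.innerW (dirac σ₀) g = g σ₀ / (X.degT σ₀ : ℝ) := by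
  unfold innerW
  simp only [mul_div_assoc]
  rw [sum_dirac_mul h (hg.div_degT X)]
  field_simp

lemma cob_dirac_cons {v : V} {τ₀ : Fin (n + 1) → V}
    (h : Function.Injective (Fin.cons v τ₀ : Fin (n + 2) → V)) :
    cob (dirac τ₀) (Fin.cons v τ₀) = 1 := by
  rw [cob_cons, dirac_self, Finset.sum_eq_zero, sub_zero]
  intro i _
  rw [dirac_eq_zero, mul_zero]
  intro π he
  have := congrFun he 0
  rw [Fin.cons_zero] at this
  exact (Fin.cons_injective_iff.1 h).1 ⟨_, this.symm⟩

/-- The exact form obtained as the (weighted) coboundary of a Dirac form. -/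
def exactDirac (X : SComplex V) (τ₀ : Fin (n + 1) → V) : (Fin (n + 2) → V) → ℝ := fun σ =>
  (X.degT σ : ℝ) * X.res (cob (dirac τ₀)) σ

lemma isAlt_exactDirac {X : SComplex V} {τ₀ : Fin (n + 1) → V} (h : Function.Injective τ₀) :
    IsAlt (X.exactDirac τ₀) := by
  intro σ π
  unfold exactDirac
  rw [degT_comp_perm, ((isAlt_dirac h).cob.res X)]
  ring

end Dirac

section Coboundary

variable [Fintype V] {X : SComplex V} {n : ℕ}

lemma dirichlet_exactDirac (hpos : ∀ σ : Fin (n + 2) → V, X.IsCellT σ → 0 < X.degT σ)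
    (τ₀ : Fin (n + 1) → V) (f : (Fin (n + 2) → V) → ℝ) :
    X.dirichlet f (X.exactDirac τ₀) = 0 := by
  have hz : ∀ τ, X.wcob (X.exactDirac τ₀) τ = 0 := by
    intro τ
    unfold wcob
    rw [res]
    split_ifs with hτ
    · rw [← cob_cob (dirac τ₀) τ]
      conv_lhs => unfold cob
      conv_rhs => rw [cob]
      refine Finset.sum_congr rfl fun j _ => ?_
      have hj := hτ.face j
      have h1 : (X.degT (τ ∘ j.succAbove) : ℝ) ≠ 0 := by exact_mod_cast (hpos _ hj).ne'
      simp only [exactDirac, res, hj, if_true]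
      rw [mul_div_cancel_left₀ _ h1]
    · rfl
  simp [dirichlet, hz]

lemma innerW_exactDirac_self_le (hpos : ∀ σ : Fin (n + 2) → V, X.IsCellT σ → 0 < X.degT σ)
    {K : ℕ} (hK : ∀ σ : Fin (n + 2) → V, X.IsCellT σ → X.degT σ ≤ K)
    {τ₀ : Fin (n + 1) → V} (h : X.IsCellT τ₀) :
    X.innerW (X.exactDirac τ₀) (X.exactDirac τ₀) ≤ (K : ℝ) * (X.degT τ₀ : ℝ) := by
  have halt : IsAlt (X.res (cob (dirac τ₀))) := (isAlt_dirac h.1).cob.res X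
  have h1 : ∀ σ : Fin (n + 2) → V,
      X.exactDirac τ₀ σ * X.exactDirac τ₀ σ / (X.degT σ : ℝ) ≤
        (K : ℝ) * (cob (dirac τ₀) σ * X.res (cob (dirac τ₀)) σ) := by
    intro σ
    by_cases hσ : X.IsCellT σ
    · have h2 : (X.degT σ : ℝ) ≠ 0 := by exact_mod_cast (hpos _ hσ).ne'
      have h3 : (X.degT σ : ℝ) ≤ K := by exact_mod_cast hK σ hσ
      simp only [exactDirac, res, hσ, if_true]
      have h4 := mul_le_mul_of_nonneg_right h3 (mul_self_nonneg (cob (dirac τ₀) σ))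
      refine le_trans (le_of_eq ?_) h4
      field_simp
    · simp [exactDirac, res, hσ]
  have h2 : ∑ σ : Fin (n + 2) → V, cob (dirac τ₀) σ * X.res (cob (dirac τ₀)) σ =
      ((n + 2).factorial : ℝ) * (X.degT τ₀ : ℝ) := by
    rw [sum_cob_mul _ halt, sum_dirac_mul h.1 halt.sum_cons, ← sum_cell_cons X h,
      Nat.factorial_succ (n + 1)]
    push_cast
    rw [← mul_assoc]
    congr 1
    refine Finset.sum_congr rfl fun v _ => ?_
    unfold res
    split_ifs with hv
    · exact cob_dirac_cons hv.1
    · rfl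
  unfold innerW
  calc _ ≤ (1 / ((n + 2).factorial : ℝ)) * ∑ σ : Fin (n + 2) → V,
        (K : ℝ) * (cob (dirac τ₀) σ * X.res (cob (dirac τ₀)) σ) :=
        mul_le_mul_of_nonneg_left (Finset.sum_le_sum fun σ _ => h1 σ) (by positivity)
    _ = _ := by
      rw [← Finset.mul_sum, h2]
      field_simp

lemma innerW_iterate_transOp_exactDirac
    (hpos : ∀ σ : Fin (n + 2) → V, X.IsCellT σ → 0 < X.degT σ)
    {f : (Fin (n + 2) → V) → ℝ} (hf : X.IsForm (n + 2) f) (p : ℝ) (τ₀ : Fin (n + 1) → V)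
    (k : ℕ) :
    X.innerW ((X.transOp p)^[k] f) (X.exactDirac τ₀) =
      (p + (1 - p) / (((n + 1 : ℕ) : ℝ) + 1)) ^ k * X.innerW f (X.exactDirac τ₀) := by
  induction k with
  | zero => simp
  | succ k ih =>
    rw [Function.iterate_succ_apply', innerW_transOp hpos (hf.iterate_transOp hpos p k),
      dirichlet_exactDirac hpos, ih, pow_succ]
    ring

end Coboundary

lemma degS_pos [Finite V] {X : SComplex V} {N : ℕ} {s : Finset V} (hs : s ∈ X.cells)
    (hne : s.Nonempty) (hcard : s.card < N)
    (huni : ∀ s ∈ X.cells, ∃ t ∈ X.cells, t.card = N ∧ s ⊆ t) : 0 < X.degS s := by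
  obtain ⟨t, ht, hc, hst⟩ := huni s hs
  obtain ⟨u, hsu, hut, hu⟩ := Finset.exists_subsuperset_card_eq hst (Nat.le_succ s.card) (by omega)
  exact (Set.ncard_pos (Set.toFinite _)).2
    ⟨u, X.down_closed ht hut (hne.mono hsu), hu, hsu⟩

lemma IsCellT.card_image {X : SComplex V} {n : ℕ} {σ : Fin n → V} (h : X.IsCellT σ) :
    (Finset.image σ Finset.univ).card = n := by
  rw [Finset.card_image_of_injective _ h.1]
  simp

end SComplex

/-- For a finite uniform `d`-dimensional complex (`d = m+2 ≥ 2`),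
`0 ≤ p < 1`, with `K1` the maximal degree of a `(d-1)`-cell and `K2` the maximal number
of `(d-1)`-cells containing a single `(d-2)`-cell, the expectation process satisfies
`(1/√(K2·K1))·((p(d-1)+1)/d)^n ≤ ‖E_n^{σ₀}‖ ≤ max(|2p-1|, (p(d-1)+1)/d)^n`. -/
theorem stmt7 {V : Type*} [Fintype V] (m : ℕ) (X : SComplex V)
    (hdim : ∀ s ∈ X.cells, s.card ≤ m + 3)
    (huni : ∀ s ∈ X.cells, ∃ t ∈ X.cells, t.card = m + 3 ∧ s ⊆ t)
    (htop : ∃ s ∈ X.cells, s.card = m + 3)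
    (p : ℝ) (hp₁ : 0 ≤ p) (hp₂ : p < 1) (K1 K2 : ℕ)
    (hK1 : IsGreatest {j : ℕ | ∃ s ∈ X.cells, s.card = m + 2 ∧ X.degS s = j} K1)
    (hK2 : IsGreatest {j : ℕ | ∃ s ∈ X.cells, s.card = m + 1 ∧ X.degS s = j} K2) :
    ∀ σ₀ : Fin (m + 2) → V, X.IsCellT σ₀ → ∀ nn : ℕ,
      (1 / Real.sqrt ((K2 : ℝ) * (K1 : ℝ))) *
          ((p * ((m : ℝ) + 1) + 1) / ((m : ℝ) + 2)) ^ nn ≤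
        X.normW ((X.transOp p)^[nn] (dirac σ₀)) ∧
      X.normW ((X.transOp p)^[nn] (dirac σ₀)) ≤
        (max |2 * p - 1| ((p * ((m : ℝ) + 1) + 1) / ((m : ℝ) + 2))) ^ nn := by
  intro σ₀ hσ₀ k
  have hpos : ∀ σ : Fin (m + 2) → V, X.IsCellT σ → 0 < X.degT σ := fun σ h =>
    degS_pos h.2 (by simp) (by rw [h.card_image]; omega) huni
  have hK : ∀ σ : Fin (m + 2) → V, X.IsCellT σ → X.degT σ ≤ K1 := fun σ h =>
    hK1.2 ⟨_, h.2, h.card_image, rfl⟩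
  have hform := isForm_dirac hσ₀
  have hm : (0 : ℝ) < (m : ℝ) + 2 := by positivity
  have hc : p + (1 - p) / (((m + 1 : ℕ) : ℝ) + 1) = (p * ((m : ℝ) + 1) + 1) / ((m : ℝ) + 2) := by
    push_cast
    rw [show (m : ℝ) + 1 + 1 = m + 2 by ring]
    field_simp
    ring
  set c : ℝ := (p * ((m : ℝ) + 1) + 1) / ((m : ℝ) + 2) with hcdef
  have hcpos : 0 < c := by positivity
  constructor
  · set τ₀ : Fin (m + 1) → V := σ₀ ∘ Fin.succ with hτ₀
    have hcell : X.IsCellT τ₀ := hσ₀.face 0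
    have hcons : (Fin.cons (σ₀ 0) τ₀ : Fin (m + 2) → V) = σ₀ := Fin.cons_self_tail σ₀
    have hτK : X.degT τ₀ ≤ K2 := hK2.2 ⟨_, hcell.2, hcell.card_image, rfl⟩
    have hcob : cob (dirac τ₀) σ₀ = 1 := by
      rw [← hcons]
      exact cob_dirac_cons (hcons ▸ hσ₀.1)
    have hdeg : (X.degT σ₀ : ℝ) ≠ 0 := by exact_mod_cast (hpos _ hσ₀).ne'
    have hinner : X.innerW ((X.transOp p)^[k] (dirac σ₀)) (X.exactDirac τ₀) = c ^ k := by
      rw [innerW_iterate_transOp_exactDirac hpos hform, hc,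
        innerW_dirac X hσ₀.1 (isAlt_exactDirac hcell.1)]
      simp [exactDirac, res, hσ₀, hcob, hdeg]
    have hz : X.innerW (X.exactDirac τ₀) (X.exactDirac τ₀) ≤ (K2 : ℝ) * K1 := by
      refine (innerW_exactDirac_self_le hpos hK hcell).trans ?_
      rw [mul_comm]
      exact mul_le_mul_of_nonneg_right (by exact_mod_cast hτK) (Nat.cast_nonneg _)
    have hKpos : (0 : ℝ) < (K2 : ℝ) * K1 := by
      have h1 : 0 < X.degT τ₀ :=
        degS_pos hcell.2 (by simp) (by rw [hcell.card_image]; omega) huni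
      have h2 := hpos _ hσ₀
      have h3 := hK _ hσ₀
      have : 0 < K2 * K1 := Nat.mul_pos (by omega) (by omega)
      exact_mod_cast this
    have hcs := innerW_sq_le (X := X) ((X.transOp p)^[k] (dirac σ₀)) (X.exactDirac τ₀)
    rw [hinner] at hcs
    rw [one_div, inv_mul_le_iff₀ (Real.sqrt_pos.2 hKpos), normW, ← Real.sqrt_mul hKpos.le]
    refine Real.le_sqrt_of_sq_le (hcs.trans ?_)
    rw [mul_comm]
    exact mul_le_mul_of_nonneg_right hz (innerW_self_nonneg _)
  · have hle := normW_iterate_transOp_le hpos hform hp₂.le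
      (hcpos.trans_le (le_max_right |2 * p - 1| c)) (le_max_left _ _)
      (hc.le.trans (le_max_right _ _)) k
    refine hle.trans (mul_le_of_le_one_right (by positivity) ?_)
    rw [normW, innerW_dirac X hσ₀.1 hform.2, dirac_self, Real.sqrt_le_one]
    have : (1 : ℝ) ≤ X.degT σ₀ := by exact_mod_cast hpos _ hσ₀
    exact div_le_one_of_le₀ this (by positivity)

end
end

section
/- Let X be a set, let A be a bounded self-adjoint operator on the Hilbert space ℓ²(X) of square-summable complex functions on X (with the counting measure), and let a < b be real numbers. Suppose that (1) for every x ∈ X and every λ ∈ [a,b] there exists ψ_x^λ ∈ ℓ²(X) with (A − λ·I)ψ_x^λ = 𝟙_x, where 𝟙_x is the indicator function of x, and (2) the function c(λ) = sup_{x∈X} ‖ψ_x^λ‖ satisfies ∫_a^b c(λ)² dλ < ∞ (the function λ ↦ c(λ)² being integrable on [a,b]). Then the open interval (a,b) does not intersect the spectrum of A. -/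
open scoped BigOperators

/-- The tent function of height and radius `ε` centred at `s`. -/
noncomputable def tent (ε s t : ℝ) : ℝ := max 0 (ε - |t - s|)

lemma tent_nonneg (ε s t : ℝ) : 0 ≤ tent ε s t := le_max_left _ _

lemma tent_le {ε : ℝ} (hε : 0 ≤ ε) (s t : ℝ) : tent ε s t ≤ ε :=
  max_le hε (by linarith [abs_nonneg (t - s)])

lemma tent_self {ε : ℝ} (hε : 0 ≤ ε) (s : ℝ) : tent ε s s = ε := by
  simp [tent, hε]

lemma tent_eq_zero {ε s t : ℝ} (h : ε ≤ |t - s|) : tent ε s t = 0 :=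
  max_eq_left (by linarith)

lemma continuous_uncurry_tent (ε : ℝ) : Continuous (Function.uncurry (tent ε)) := by
  unfold tent Function.uncurry
  fun_prop

lemma continuous_tent (ε s : ℝ) : Continuous (tent ε s) := by
  unfold tent
  fun_prop

lemma continuous_tent_center (ε t : ℝ) : Continuous (fun s => tent ε s t) := by
  unfold tent
  fun_prop

lemma tent_mul_sub_abs_le {ε : ℝ} (hε : 0 ≤ ε) (s t : ℝ) : |tent ε s t * (t - s)| ≤ ε ^ 2 := by
  rcases le_total ε |t - s| with h | h
  · simp [tent_eq_zero h, sq_nonneg]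
  · rw [abs_mul, abs_of_nonneg (tent_nonneg ε s t), sq]
    exact mul_le_mul (tent_le hε s t) h (abs_nonneg _) hε

/-- Averaging squared tents over their centres gives a large contribution at every point at
distance at least `ε / 2` from the end points. -/
lemma le_setIntegral_tent_sq {ε a b t : ℝ} (hε : 0 ≤ ε) (ha : a ≤ t - ε / 2)
    (hb : t + ε / 2 ≤ b) : ε ^ 3 / 4 ≤ ∫ s in Set.Icc a b, tent ε s t ^ 2 := by
  have hcont : Continuous fun s => tent ε s t ^ 2 := (continuous_tent_center ε t).pow 2
  have hsub : Set.Icc (t - ε / 2) (t + ε / 2) ⊆ Set.Icc a b := Set.Icc_subset_Icc ha hb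
  calc ε ^ 3 / 4 = ∫ _s in Set.Icc (t - ε / 2) (t + ε / 2), (ε / 2) ^ 2 := by
        rw [MeasureTheory.setIntegral_const, MeasureTheory.measureReal_def, Real.volume_Icc,
          ENNReal.toReal_ofReal (by linarith), smul_eq_mul]
        ring
    _ ≤ ∫ s in Set.Icc (t - ε / 2) (t + ε / 2), tent ε s t ^ 2 := by
        refine MeasureTheory.setIntegral_mono_on (by simp)
          (hcont.continuousOn.integrableOn_Icc) measurableSet_Icc fun s hs => ?_
        have h : |t - s| ≤ ε / 2 := abs_le.2 ⟨by linarith [hs.2], by linarith [hs.1]⟩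
        have : ε / 2 ≤ tent ε s t := le_max_of_le_right (by linarith)
        gcongr
    _ ≤ _ := MeasureTheory.setIntegral_mono_set hcont.continuousOn.integrableOn_Icc
        (Filter.Eventually.of_forall fun s => sq_nonneg _) hsub.eventuallyLE

section Hilbert

variable {H : Type*} [NormedAddCommGroup H] [InnerProductSpace ℂ H] [CompleteSpace H]
  {A : H →L[ℂ] H}

lemma norm_cfc_tent_apply_le (hA : IsSelfAdjoint A) {ε : ℝ} (hε : 0 ≤ ε) {s : ℝ} {u v : H}
    (h : A u - (s : ℂ) • u = v) : ‖cfc (tent ε s) A v‖ ≤ ε ^ 2 * ‖u‖ := by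
  have hc := continuous_tent ε s
  have hmul : cfc (fun t => tent ε s t * (t - s)) A
      = cfc (tent ε s) A * (A - algebraMap ℝ _ s) := by
    rw [cfc_mul (tent ε s) (fun t => t - s) A hc.continuousOn (by fun_prop),
      cfc_sub (fun t => t) (fun _ => s) A, cfc_id' ℝ A, cfc_const s A]
  have hv : cfc (tent ε s) A v = cfc (fun t => tent ε s t * (t - s)) A u := by
    rw [hmul, ← h]
    simp [Algebra.algebraMap_eq_smul_one]
  rw [hv]
  refine (ContinuousLinearMap.le_opNorm _ _).trans ?_
  gcongr
  exact norm_cfc_le (sq_nonneg ε) fun t _ => tent_mul_sub_abs_le hε s t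

lemma inner_cfc_sq_apply (f : ℝ → ℝ) (hf : Continuous f) (hA : IsSelfAdjoint A) (v : H) :
    inner ℂ v (cfc (fun t => f t ^ 2) A v) = ((‖cfc f A v‖ ^ 2 : ℝ) : ℂ) := by
  have hsa : IsSelfAdjoint (cfc f A) := cfc_predicate f A
  rw [cfc_pow f 2 A hf.continuousOn, sq, mul_apply_eq_comp,
    ← ContinuousLinearMap.adjoint_inner_left, hsa.adjoint_eq, inner_self_eq_norm_sq_to_K]
  simp

/-- If the resolvent equation is solvable at `v` with square-integrable bounds along `[a, b]`,
then `v` has no spectral mass in the interior of `[a, b]`. -/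
lemma cfc_tent_apply_eq_zero (hA : IsSelfAdjoint A) {a b s δ : ℝ} (hδ : 0 < δ)
    (ha : a ≤ s - 2 * δ) (hb : s + 2 * δ ≤ b) {v : H} (ψ : ℝ → H)
    (hψ : ∀ r ∈ Set.Icc a b, A (ψ r) - (r : ℂ) • ψ r = v) (c : ℝ → ℝ)
    (hc : ∀ r ∈ Set.Icc a b, ‖ψ r‖ ≤ c r)
    (hint : MeasureTheory.IntegrableOn (fun r => c r ^ 2) (Set.Icc a b)) :
    cfc (tent δ s) A v = 0 := by
  set K := ∫ r in Set.Icc a b, c r ^ 2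
  have key : ∀ ε : ℝ, 0 < ε → ε ≤ δ → ‖cfc (tent δ s) A v‖ ^ 2 ≤ 4 * δ ^ 2 * K * ε := by
    intro ε hε hεδ
    have hcont2 : Continuous (Function.uncurry fun r t => tent ε r t ^ 2) :=
      (continuous_uncurry_tent ε).pow 2
    have hcontF : Continuous fun t => ∫ r in Set.Icc a b, tent ε r t ^ 2 := by
      refine continuous_parametric_integral_of_continuous ?_ isCompact_Icc
      exact hcont2.comp continuous_swap
    have hbd : ∀ᵐ r ∂(MeasureTheory.volume.restrict (Set.Icc a b)), ∀ z ∈ spectrum ℝ A,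
        ‖tent ε r z ^ 2‖ ≤ ε ^ 2 := by
      refine Filter.Eventually.of_forall fun r z _ => ?_
      rw [Real.norm_of_nonneg (sq_nonneg _)]
      have := tent_le hε.le r z
      have := tent_nonneg ε r z
      gcongr
    have hfin : MeasureTheory.HasFiniteIntegral (fun _ : ℝ => ε ^ 2)
        (MeasureTheory.volume.restrict (Set.Icc a b)) :=
      (MeasureTheory.integrable_const _).2
    have hF : cfc (fun t => ∫ r in Set.Icc a b, tent ε r t ^ 2) A
        = ∫ r in Set.Icc a b, cfc (fun t => tent ε r t ^ 2) A :=
      cfc_setIntegral measurableSet_Icc _ (fun _ => ε ^ 2) A hcont2.continuousOn hbd hfin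
    have hFint : MeasureTheory.IntegrableOn (fun r => cfc (fun t => tent ε r t ^ 2) A)
        (Set.Icc a b) :=
      integrableOn_cfc measurableSet_Icc _ (fun _ => ε ^ 2) A hcont2.continuousOn hbd hfin
    let L : (H →L[ℂ] H) →L[ℝ] ℝ :=
      (Complex.reCLM.comp ((innerSL ℂ v).restrictScalars ℝ)).comp
        ((ContinuousLinearMap.apply ℂ H v).restrictScalars ℝ)
    have hL : ∀ T : H →L[ℂ] H, L T = (inner ℂ v (T v)).re := fun T => rfl
    have hLsq : ∀ f : ℝ → ℝ, Continuous f → L (cfc (fun t => f t ^ 2) A) = ‖cfc f A v‖ ^ 2 :=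
      fun f hf => by rw [hL, inner_cfc_sq_apply f hf hA, Complex.ofReal_re]
    have hLF : L (cfc (fun t => ∫ r in Set.Icc a b, tent ε r t ^ 2) A) ≤ ε ^ 4 * K := by
      rw [hF, ← L.integral_comp_comm hFint, ← MeasureTheory.integral_const_mul]
      refine MeasureTheory.setIntegral_mono_on (L.integrable_comp hFint) (hint.const_mul _)
        measurableSet_Icc fun r hr => ?_
      rw [hLsq _ (continuous_tent ε r)]
      calc ‖cfc (tent ε r) A v‖ ^ 2 ≤ (ε ^ 2 * c r) ^ 2 := by
            have := hc r hr
            gcongr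
            exact (norm_cfc_tent_apply_le hA hε.le (hψ r hr)).trans (by gcongr)
        _ = ε ^ 4 * c r ^ 2 := by ring
    have hmono : cfc (fun t => ε ^ 3 / 4 * tent δ s t ^ 2) A
        ≤ cfc (fun t => δ ^ 2 * ∫ r in Set.Icc a b, tent ε r t ^ 2) A := by
      refine cfc_mono (fun t _ => ?_)
        (((continuous_tent δ s).pow 2).const_mul _).continuousOn
        (hcontF.const_mul _).continuousOn
      rcases le_total δ |t - s| with h | h
      · rw [tent_eq_zero h]
        have : 0 ≤ ∫ r in Set.Icc a b, tent ε r t ^ 2 :=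
          MeasureTheory.integral_nonneg fun r => sq_nonneg _
        simpa using mul_nonneg (sq_nonneg δ) this
      · have h' := abs_le.1 h
        rw [mul_comm]
        have := le_setIntegral_tent_sq hε.le (a := a) (b := b) (t := t)
          (by linarith) (by linarith)
        have h1 := tent_le hδ.le s t
        have h2 := tent_nonneg δ s t
        gcongr
    have hLmono : ∀ S T : H →L[ℂ] H, S ≤ T → L S ≤ L T := by
      intro S T h
      have := ((ContinuousLinearMap.le_def S T).1 h).re_inner_nonneg_right v
      rw [← sub_nonneg, ← map_sub, hL]
      exact this
    have h := hLmono _ _ hmono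
    rw [cfc_const_mul _ (fun t => tent δ s t ^ 2) A ((continuous_tent δ s).pow 2).continuousOn,
      cfc_const_mul _ _ A hcontF.continuousOn, map_smul, map_smul, hLsq _ (continuous_tent δ s),
      smul_eq_mul, smul_eq_mul] at h
    have h3 : 0 < ε ^ 3 := by positivity
    have h4 := h.trans (mul_le_mul_of_nonneg_left hLF (sq_nonneg δ))
    refine le_of_mul_le_mul_left ?_ h3
    linarith
  have hlim : Filter.Tendsto (fun ε : ℝ => 4 * δ ^ 2 * K * ε) (nhdsWithin 0 (Set.Ioi 0))
      (nhds 0) := by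
    have : Continuous fun ε : ℝ => 4 * δ ^ 2 * K * ε := by fun_prop
    simpa using (this.tendsto 0).mono_left nhdsWithin_le_nhds
  have hle : ‖cfc (tent δ s) A v‖ ^ 2 ≤ 0 := by
    refine ge_of_tendsto hlim ?_
    filter_upwards [Ioc_mem_nhdsGT hδ] with ε hε using key ε hε.1 hε.2
  exact norm_eq_zero.1 (pow_eq_zero_iff two_ne_zero |>.1 (le_antisymm hle (sq_nonneg _)))

/-- If the resolvent equation is solvable, with square-integrable bounds along `[a, b]`, on a
family of vectors on which operators are determined, then `(a, b)` avoids the spectrum. -/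
lemma not_mem_spectrum_of_resolvent_sq_integrable (hA : IsSelfAdjoint A) {X : Type*} {v : X → H}
    {a b : ℝ} (ψ : X → ℝ → H)
    (hψ : ∀ x, ∀ r ∈ Set.Icc a b, A (ψ x r) - (r : ℂ) • ψ x r = v x) (c : ℝ → ℝ)
    (hc : ∀ x, ∀ r ∈ Set.Icc a b, ‖ψ x r‖ ≤ c r)
    (hint : MeasureTheory.IntegrableOn (fun r => c r ^ 2) (Set.Icc a b))
    (htotal : ∀ T : H →L[ℂ] H, (∀ x, T (v x) = 0) → T = 0) {s : ℝ} (hs : s ∈ Set.Ioo a b) :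
    (s : ℂ) ∉ spectrum ℂ A := by
  intro hspec
  obtain ⟨δ, hδ, hδa, hδb⟩ : ∃ δ : ℝ, 0 < δ ∧ a ≤ s - 2 * δ ∧ s + 2 * δ ≤ b := by
    have h1 := hs.1
    have h2 := hs.2
    refine ⟨min (s - a) (b - s) / 2, half_pos (lt_min (by linarith) (by linarith)), ?_, ?_⟩
    · linarith [min_le_left (s - a) (b - s)]
    · linarith [min_le_right (s - a) (b - s)]
  have hzero : cfc (tent δ s) A = 0 := htotal _ fun x =>
    cfc_tent_apply_eq_zero hA hδ hδa hδb (ψ x) (hψ x) c (hc x) hint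
  have hs' : s ∈ spectrum ℝ A := spectrum.of_algebraMap_mem ℂ hspec
  have hmem : tent δ s s ∈ spectrum ℝ (cfc (tent δ s) A) := by
    rw [cfc_map_spectrum (tent δ s) A hA (continuous_tent δ s).continuousOn]
    exact ⟨s, hs', rfl⟩
  rw [hzero, tent_self hδ.le, spectrum.mem_iff, sub_zero] at hmem
  exact hmem ((IsUnit.mk0 δ hδ.ne').map (algebraMap ℝ _))

end Hilbert

lemma lp_clm_eq_zero_of_single {X : Type*} [DecidableEq X]
    {T : lp (fun _ : X => ℂ) 2 →L[ℂ] lp (fun _ : X => ℂ) 2}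
    (h : ∀ x, T (lp.single (E := fun _ : X => ℂ) 2 x (1 : ℂ)) = 0) : T = 0 := by
  ext1 f
  have hs := (lp.hasSum_single (by simp) f).mapL T
  refine hs.unique ?_
  have hz : ∀ x, T (lp.single 2 x (f x)) = 0 := fun x => by
    have : lp.single (E := fun _ : X => ℂ) 2 x (f x)
        = f x • lp.single (E := fun _ : X => ℂ) 2 x (1 : ℂ) := by
      rw [← lp.single_smul]; simp
    rw [this, map_smul, h, smul_zero]
  simp [hz]

/-- Let `A` be a bounded self-adjoint operator on `ℓ²(X)`, and
`a < b` reals. If for every `x ∈ X` and `λ ∈ [a,b]` there is `ψ_x^λ ∈ ℓ²(X)` with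
`(A - λ)ψ_x^λ = 𝟙_x`, and there is a bound `c(λ) ≥ sup_x ‖ψ_x^λ‖` with
`∫_a^b c(λ)² dλ < ∞`, then `(a,b)` does not meet the spectrum of `A`. -/
theorem stmt8 {X : Type*} [DecidableEq X]
    (A : lp (fun _ : X => ℂ) 2 →L[ℂ] lp (fun _ : X => ℂ) 2)
    (hA : IsSelfAdjoint A) (a b : ℝ) (hab : a < b)
    (ψ : X → ℝ → lp (fun _ : X => ℂ) 2)
    (hψ : ∀ (x : X), ∀ lam ∈ Set.Icc a b,
      A (ψ x lam) - (lam : ℂ) • ψ x lam = lp.single (E := fun _ : X => ℂ) 2 x (1 : ℂ))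
    (c : ℝ → ℝ) (hc : ∀ (x : X), ∀ lam ∈ Set.Icc a b, ‖ψ x lam‖ ≤ c lam)
    (hint : MeasureTheory.IntegrableOn (fun lam => (c lam) ^ 2) (Set.Icc a b)) :
    ∀ lam ∈ Set.Ioo a b, (lam : ℂ) ∉ spectrum ℂ A := by
  intro s hs
  exact not_mem_spectrum_of_resolvent_sq_integrable hA ψ hψ c hc hint
    (fun _ => lp_clm_eq_zero_of_single) hs
end

section
/- Let d ≥ 2 and let X be a uniform d-dimensional simplicial complex, finite or countably infinite, in which every (d−1)-cell has finite degree. Suppose τ is a (d−2)-cell of X that is contained in only finitely many (d−1)-cells, and σ is a (d−1)-cell containing τ. Then there is no d-form f on X with ∂_d f = 1_σ (for either orientation of σ). -/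
open scoped BigOperators Classical
open Filter Topology

noncomputable section

namespace SComplex

variable {V : Type*}

theorem exists_perm_of_image_eq {n : ℕ} {σ ρ : Fin n → V} (hσ : Function.Injective σ)
    (hρ : Function.Injective ρ)
    (h : Finset.image ρ Finset.univ = Finset.image σ Finset.univ) :
    ∃ π : Equiv.Perm (Fin n), ρ = σ ∘ π := by
  have hr : Set.range ρ = Set.range σ := by
    simpa using congrArg (fun s : Finset V => (s : Set V)) h
  refine ⟨((Equiv.ofInjective ρ hρ).trans (Equiv.setCongr hr)).trans
    (Equiv.ofInjective σ hσ).symm, ?_⟩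
  funext i
  simp [Equiv.apply_ofInjective_symm]

theorem dirac_comp_perm_ne_zero {n : ℕ} (σ : Fin n → V) (π : Equiv.Perm (Fin n)) :
    dirac σ (σ ∘ π) ≠ 0 := by
  unfold dirac
  split_ifs with h₁ h₂
  · norm_num
  · norm_num
  · rcases Int.units_eq_one_or (Equiv.Perm.sign π) with h | h
    · exact absurd ⟨π, h, rfl⟩ h₁
    · exact absurd ⟨π, h, rfl⟩ h₂

theorem dirac_eq_zero_of_image_ne {n : ℕ} {σ ρ : Fin n → V}
    (h : Finset.image ρ Finset.univ ≠ Finset.image σ Finset.univ) : dirac σ ρ = 0 := by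
  have key : ∀ π : Equiv.Perm (Fin n), ρ ≠ σ ∘ π := by
    rintro π rfl
    refine h (Finset.coe_injective ?_)
    simpa only [Finset.coe_image, Finset.coe_univ, Set.image_univ] using
      EquivLike.range_comp σ π
  unfold dirac
  rw [if_neg (fun ⟨π, _, e⟩ => key π e), if_neg (fun ⟨π, _, e⟩ => key π e)]

theorem image_cons_univ {n : ℕ} (v : V) (ρ : Fin n → V) :
    Finset.image (Fin.cons v ρ : Fin (n + 1) → V) Finset.univ =
      insert v (Finset.image ρ Finset.univ) := by
  apply Finset.coe_injective
  simp [Fin.range_cons]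

theorem cons_cons_comp_swap {n : ℕ} (v w : V) (ρ : Fin n → V) :
    (Fin.cons v (Fin.cons w ρ : Fin (n + 1) → V) : Fin (n + 2) → V) ∘
      Equiv.swap (0 : Fin (n + 2)) 1 = Fin.cons w (Fin.cons v ρ : Fin (n + 1) → V) := by
  funext i
  refine Fin.cases ?_ (fun j => Fin.cases ?_ (fun k => ?_) j) i
  · simp only [Function.comp_apply, Equiv.swap_apply_left]; rfl
  · simp only [Function.comp_apply, Fin.succ_zero_eq_one, Equiv.swap_apply_right]; rfl
  · rw [Function.comp_apply, Equiv.swap_apply_of_ne_of_ne (Fin.succ_ne_zero _)]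
    · rfl
    · rw [← Fin.succ_zero_eq_one]
      exact fun h => Fin.succ_ne_zero k (Fin.succ_injective _ h)

theorem IsForm.cons_cons_swap {X : SComplex V} {n : ℕ} {f : (Fin (n + 2) → V) → ℝ}
    (hf : X.IsForm (n + 2) f) (v w : V) (ρ : Fin n → V) :
    f (Fin.cons w (Fin.cons v ρ : Fin (n + 1) → V)) =
      -f (Fin.cons v (Fin.cons w ρ : Fin (n + 1) → V)) := by
  rw [← cons_cons_comp_swap, hf.2, Equiv.Perm.sign_swap (by simp)]
  simp

theorem IsCellT.of_cons_cons {X : SComplex V} {n : ℕ} {v w : V} {ρ : Fin n → V}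
    (h : X.IsCellT (Fin.cons v (Fin.cons w ρ : Fin (n + 1) → V) : Fin (n + 2) → V)) :
    X.IsCellT (Fin.cons v ρ : Fin (n + 1) → V) := by
  obtain ⟨hinj, hcell⟩ := h
  rw [Fin.cons_injective_iff, Fin.cons_injective_iff, Fin.range_cons] at hinj
  refine ⟨Fin.cons_injective_iff.2 ⟨fun h => hinj.1 (Or.inr h), hinj.2.2⟩,
    X.down_closed hcell ?_ (by simp)⟩
  simp only [image_cons_univ]
  exact Finset.insert_subset_insert _ (Finset.subset_insert _ _)

theorem finite_setOf_isCellT_cons (X : SComplex V) {n : ℕ} {ρ : Fin n → V}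
    (h : {t : Finset V | t ∈ X.cells ∧ t.card = n + 1 ∧
      Finset.image ρ Finset.univ ⊆ t}.Finite) :
    {v : V | X.IsCellT (Fin.cons v ρ : Fin (n + 1) → V)}.Finite := by
  refine Set.Finite.of_injOn (f := fun v => insert v (Finset.image ρ Finset.univ))
    (fun v hv => ?_) (fun v hv w hw hvw => ?_) h
  · beta_reduce
    rw [← image_cons_univ]
    refine ⟨hv.2, ?_, image_cons_univ v ρ ▸ Finset.subset_insert _ _⟩
    rw [Finset.card_image_of_injective _ hv.1, Finset.card_univ,
      Fintype.card_fin]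
  · have hv' : v ∉ Finset.image ρ Finset.univ := by
      simpa using (Fin.cons_injective_iff.1 hv.1).1
    have hmem : v ∈ insert w (Finset.image ρ Finset.univ) := by
      rw [← show insert v (Finset.image ρ Finset.univ) =
        insert w (Finset.image ρ Finset.univ) from hvw]
      exact Finset.mem_insert_self _ _
    exact (Finset.mem_insert.1 hmem).resolve_right hv'

/-- The boundary of a boundary vanishes at a cell contained in finitely many cells of
the next dimension. -/
theorem IsForm.sum_bdry_cons_eq_zero {X : SComplex V} {n : ℕ} {f : (Fin (n + 2) → V) → ℝ}
    (hf : X.IsForm (n + 2) f) {ρ : Fin n → V} {W : Finset V}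
    (hW : ∀ v, X.IsCellT (Fin.cons v ρ : Fin (n + 1) → V) → v ∈ W) :
    ∑ w ∈ W, X.bdry f (Fin.cons w ρ : Fin (n + 1) → V) = 0 := by
  have hb : ∀ w, X.bdry f (Fin.cons w ρ : Fin (n + 1) → V) =
      ∑ v ∈ W, f (Fin.cons v (Fin.cons w ρ : Fin (n + 1) → V)) := by
    intro w
    refine finsum_mem_eq_sum_of_inter_support_eq _ (Set.ext fun v => ?_)
    simp only [Set.mem_inter_iff, Set.mem_ofPred_eq, Function.mem_support, Finset.mem_coe]
    refine and_congr_left fun hv => ?_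
    have hc := not_imp_comm.1 (hf.1 (Fin.cons v (Fin.cons w ρ : Fin (n + 1) → V))) hv
    exact ⟨fun h => hW v h.of_cons_cons, fun _ => hc⟩
  simp only [hb]
  have hneg : ∑ w ∈ W, ∑ v ∈ W, f (Fin.cons v (Fin.cons w ρ : Fin (n + 1) → V)) =
      -∑ w ∈ W, ∑ v ∈ W, f (Fin.cons v (Fin.cons w ρ : Fin (n + 1) → V)) := by
    conv_lhs => rw [Finset.sum_comm]
    simp only [← Finset.sum_neg_distrib]
    exact Finset.sum_congr rfl fun v _ => Finset.sum_congr rfl fun w _ =>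
      hf.cons_cons_swap w v ρ
  linarith

end SComplex

open SComplex

/-- Let `X` be a uniform `d`-complex (`d = m+2 ≥ 2`) on a countable
vertex set in which every `(d-1)`-cell has finite degree. If the `(d-2)`-cell `sτ` is
contained in only finitely many `(d-1)`-cells and `σ₀` is a `(d-1)`-cell containing
`sτ`, then no `d`-form `f` satisfies `∂_d f = 𝟙_{σ₀}`. -/
theorem stmt16 {V : Type*} [Countable V] (m : ℕ) (X : SComplex V)
    (hdim : ∀ s ∈ X.cells, s.card ≤ m + 3)
    (huni : ∀ s ∈ X.cells, ∃ t ∈ X.cells, t.card = m + 3 ∧ s ⊆ t)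
    (htop : ∃ s ∈ X.cells, s.card = m + 3)
    (hfin : ∀ s ∈ X.cells, s.card = m + 2 →
      {t : Finset V | t ∈ X.cells ∧ t.card = m + 3 ∧ s ⊆ t}.Finite)
    (sτ : Finset V) (hτ : sτ ∈ X.cells) (hτcard : sτ.card = m + 1)
    (hτfin : {t : Finset V | t ∈ X.cells ∧ t.card = m + 2 ∧ sτ ⊆ t}.Finite)
    (σ₀ : Fin (m + 2) → V) (hσ₀ : X.IsCellT σ₀)
    (hsub : sτ ⊆ Finset.image σ₀ Finset.univ) :
    ¬ ∃ f : (Fin (m + 3) → V) → ℝ, X.IsForm (m + 3) f ∧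
        ∀ ρ : Fin (m + 2) → V, X.bdry f ρ = dirac σ₀ ρ := by
  rintro ⟨f, hf, hbd⟩
  obtain ⟨ρ, hρ, rfl⟩ : ∃ ρ : Fin (m + 1) → V,
      Function.Injective ρ ∧ Finset.image ρ Finset.univ = sτ := by
    refine ⟨fun i => (sτ.equivFinOfCardEq hτcard).symm i,
      Subtype.val_injective.comp (Equiv.injective _), Finset.coe_injective ?_⟩
    rw [Finset.coe_image, Finset.coe_univ, Set.image_univ]
    exact (EquivLike.range_comp _ _).trans Subtype.range_coe
  have hW := X.finite_setOf_isCellT_cons hτfin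
  have hsum := hf.sum_bdry_cons_eq_zero (ρ := ρ) (W := hW.toFinset) (by simp)
  have hcard : (Finset.image σ₀ Finset.univ).card =
      (Finset.image ρ Finset.univ).card + 1 := by
    rw [hτcard, Finset.card_image_of_injective _ hσ₀.1, Finset.card_univ, Fintype.card_fin]
  obtain ⟨w, hw, himg⟩ : ∃ w ∉ Finset.image ρ Finset.univ,
      insert w (Finset.image ρ Finset.univ) = Finset.image σ₀ Finset.univ := by
    rw [← Finset.covBy_iff_exists_insert, Finset.covBy_iff_card_sdiff_eq_one]
    exact ⟨hsub, by rw [Finset.card_sdiff_of_subset hsub]; omega⟩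
  have hinj : Function.Injective (Fin.cons w ρ : Fin (m + 2) → V) :=
    Fin.cons_injective_iff.2 ⟨by simpa using hw, hρ⟩
  have himg' := (image_cons_univ w ρ).trans himg
  obtain ⟨π, hπ⟩ := exists_perm_of_image_eq hσ₀.1 hinj himg'
  refine dirac_comp_perm_ne_zero σ₀ π ?_
  rw [← hπ, ← hsum]
  simp only [hbd]
  symm
  refine Finset.sum_eq_single_of_mem w ?_ fun v hv hvw => ?_
  · exact hW.mem_toFinset.2 ⟨hinj, himg' ▸ hσ₀.2⟩
  · refine dirac_eq_zero_of_image_ne fun h => hvw ?_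
    rw [image_cons_univ, ← himg] at h
    have hmem : w ∈ insert v (Finset.image ρ Finset.univ) :=
      h ▸ Finset.mem_insert_self _ _
    exact ((Finset.mem_insert.1 hmem).resolve_right hw).symm

end
end
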